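/- Let 0<α<n and 1<p<q<∞, and set β=n(1/p−1/q). Let Ψ be a Young function whose associate function Ψ̄ satisfies the B^β_{q'} condition, and suppose the pair of weights (u,σ) satisfies [σ,u]_{A^α_{q',p',Ψ}}<∞. Then ‖I_α(·σ)‖_{L^p(σ)→L^{q,∞}(u)} ≤ C·[σ,u]_{A^α_{q',p',Ψ}}·‖M_{β,Ψ̄}‖_{L^{q'}→L^{p'}}, where C depends only on n, α, p and q. -/

import Mathlib

open MeasureTheory ENNReal Set

noncomputable section

/-- `ℝ^n` with Lebesgue measure. -/
abbrev Rn (n : ℕ) : Type := Fin n → ℝ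

/-- An axis-parallel (half-open) cube in `ℝ^n`. -/
structure Cube (n : ℕ) where
  corner : Fin n → ℝ
  side : ℝ
  side_pos : 0 < side

/-- The underlying set of a cube. -/
def Cube.set {n : ℕ} (Q : Cube n) : Set (Rn n) :=
  {x | ∀ i, Q.corner i ≤ x i ∧ x i < Q.corner i + Q.side}

/-- The volume `|Q|` of a cube. -/
def Cube.vol {n : ℕ} (Q : Cube n) : ℝ := Q.side ^ n

/-- Conjugate exponent `p' = p/(p-1)`. -/
def conjExp (p : ℝ) : ℝ := p / (p - 1)

/-- Average over a cube of an `ℝ≥0∞`-valued function. -/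
def avgE {n : ℕ} (Q : Cube n) (g : Rn n → ℝ≥0∞) : ℝ≥0∞ :=
  (∫⁻ x in Q.set, g x) / ENNReal.ofReal Q.vol

/-- Average over a cube of a (nonnegative) real weight. -/
def avgW {n : ℕ} (Q : Cube n) (w : Rn n → ℝ) : ℝ≥0∞ :=
  avgE Q fun x => ENNReal.ofReal (w x)

/-- Weighted `L^p` norm `‖f‖_{L^p(w)}` of an `ℝ≥0∞`-valued function. -/
def LpW {n : ℕ} (f : Rn n → ℝ≥0∞) (p : ℝ) (w : Rn n → ℝ) : ℝ≥0∞ :=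
  (∫⁻ x, f x ^ p * ENNReal.ofReal (w x)) ^ (1 / p)

/-- Weighted weak `L^q` quasinorm `‖f‖_{L^{q,∞}(w)}`. -/
def WeakLpW {n : ℕ} (f : Rn n → ℝ≥0∞) (q : ℝ) (w : Rn n → ℝ) : ℝ≥0∞ :=
  ⨆ (t : ℝ) (_ : 0 < t),
    ENNReal.ofReal t *
      (∫⁻ x in {x | ENNReal.ofReal t < f x}, ENNReal.ofReal (w x)) ^ (1 / q)

/-- The fractional maximal operator `M_α`. -/
def fracMax {n : ℕ} (α : ℝ) (f : Rn n → ℝ≥0∞) (x : Rn n) : ℝ≥0∞ :=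
  ⨆ (Q : Cube n) (_ : x ∈ Q.set),
    ENNReal.ofReal (Q.vol ^ (α / n - 1)) * ∫⁻ y in Q.set, f y

/-- The Euclidean norm on `ℝ^n`. -/
def eucNorm {n : ℕ} (x : Rn n) : ℝ := Real.sqrt (∑ i, x i ^ 2)

/-- The Riesz potential `I_α`. -/
def riesz {n : ℕ} (α : ℝ) (f : Rn n → ℝ≥0∞) (x : Rn n) : ℝ≥0∞ :=
  ∫⁻ y, f y * ENNReal.ofReal (eucNorm (x - y) ^ (α - n))

/-- The product `fσ` of an `ℝ≥0∞`-valued function with a weight. -/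
def mulW {n : ℕ} (f : Rn n → ℝ≥0∞) (w : Rn n → ℝ) : Rn n → ℝ≥0∞ :=
  fun x => f x * ENNReal.ofReal (w x)

/-- The operator norm `‖T(·σ)‖_{L^p(σ) → L^q(u)}` (least admissible constant). -/
def opNormStrong {n : ℕ} (T : (Rn n → ℝ≥0∞) → Rn n → ℝ≥0∞) (p q : ℝ)
    (σ u : Rn n → ℝ) : ℝ≥0∞ :=
  ⨆ (f : Rn n → ℝ≥0∞) (_ : Measurable f), LpW (T (mulW f σ)) q u / LpW f p σ

/-- The weak-type operator norm `‖T(·σ)‖_{L^p(σ) → L^{q,∞}(u)}`. -/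
def opNormWeak {n : ℕ} (T : (Rn n → ℝ≥0∞) → Rn n → ℝ≥0∞) (p q : ℝ)
    (σ u : Rn n → ℝ) : ℝ≥0∞ :=
  ⨆ (f : Rn n → ℝ≥0∞) (_ : Measurable f), WeakLpW (T (mulW f σ)) q u / LpW f p σ

/-- The operator norm `‖T‖_{L^p(v) → L^q(u)}` (no multiplication by the weight). -/
def opNormPlain {n : ℕ} (T : (Rn n → ℝ≥0∞) → Rn n → ℝ≥0∞) (p q : ℝ)
    (v u : Rn n → ℝ) : ℝ≥0∞ :=
  ⨆ (f : Rn n → ℝ≥0∞) (_ : Measurable f), LpW (T f) q u / LpW f p v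

/-- The weak-type operator norm `‖T‖_{L^p(v) → L^{q,∞}(u)}`. -/
def opNormPlainWeak {n : ℕ} (T : (Rn n → ℝ≥0∞) → Rn n → ℝ≥0∞) (p q : ℝ)
    (v u : Rn n → ℝ) : ℝ≥0∞ :=
  ⨆ (f : Rn n → ℝ≥0∞) (_ : Measurable f), WeakLpW (T f) q u / LpW f p v

/-- A weight: a nonnegative locally integrable (measurable) function. -/
def IsWeight {n : ℕ} (w : Rn n → ℝ) : Prop :=
  Measurable w ∧ (∀ x, 0 ≤ w x) ∧ LocallyIntegrable w volume

/-- The local `A^α_{p,q}` functional `A^α_{p,q}(u,σ,Q)`. -/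
def ApqQ {n : ℕ} (α p q : ℝ) (u σ : Rn n → ℝ) (Q : Cube n) : ℝ≥0∞ :=
  ENNReal.ofReal (Q.vol ^ (α / n + 1 / q - 1 / p)) * avgW Q u ^ (1 / q) *
    avgW Q σ ^ (1 / conjExp p)

/-- The joint constant `[u,σ]_{A^α_{p,q}}`. -/
def Apq {n : ℕ} (α p q : ℝ) (u σ : Rn n → ℝ) : ℝ≥0∞ :=
  ⨆ Q : Cube n, ApqQ α p q u σ Q

/-- `A^α_{p,q}` for `ℝ≥0∞`-valued weights. -/
def ApqE {n : ℕ} (α p q : ℝ) (u σ : Rn n → ℝ≥0∞) : ℝ≥0∞ :=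
  ⨆ Q : Cube n,
    ENNReal.ofReal (Q.vol ^ (α / n + 1 / q - 1 / p)) * avgE Q u ^ (1 / q) *
      avgE Q σ ^ (1 / conjExp p)

/-- Real-valued average over a cube. -/
def avgR {n : ℕ} (Q : Cube n) (w : Rn n → ℝ) : ℝ := (∫ x in Q.set, w x) / Q.vol

/-- The local exponential `A_∞` functional `A^{exp}_∞(w,Q)`. -/
def AexpQ {n : ℕ} (Q : Cube n) (w : Rn n → ℝ) : ℝ :=
  avgR Q w * Real.exp (- avgR Q fun x => Real.log (w x))

/-- `w ∈ A_∞` (exponential definition). -/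
def IsAinf {n : ℕ} (w : Rn n → ℝ) : Prop :=
  ∃ C : ℝ, ∀ Q : Cube n,
    IntegrableOn (fun x => Real.log (w x)) Q.set volume ∧ AexpQ Q w ≤ C

/-- The local Fujii–Wilson functional `A^M_∞(w,Q) = w(Q)⁻¹ ∫_Q M(wχ_Q)`. -/
def FWQ {n : ℕ} (Q : Cube n) (w : Rn n → ℝ) : ℝ≥0∞ :=
  (∫⁻ x in Q.set, fracMax 0 (Q.set.indicator fun y => ENNReal.ofReal (w y)) x) /
    ∫⁻ x in Q.set, ENNReal.ofReal (w x)

/-- The Fujii–Wilson constant `[w]_{A^M_∞}`. -/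
def FW {n : ℕ} (w : Rn n → ℝ) : ℝ≥0∞ := ⨆ Q : Cube n, FWQ Q w

/-- The local Muckenhoupt `A_r` functional. -/
def ArQ {n : ℕ} (r : ℝ) (v : Rn n → ℝ) (Q : Cube n) : ℝ≥0∞ :=
  avgW Q v * (avgE Q fun x => ENNReal.ofReal (v x) ^ (1 - conjExp r)) ^ (r - 1)

/-- The Muckenhoupt constant `[v]_{A_r}`. -/
def ArC {n : ℕ} (r : ℝ) (v : Rn n → ℝ) : ℝ≥0∞ := ⨆ Q : Cube n, ArQ r v Q

/-- The mixed constant `[v]_{(A_r)^β (A^M_∞)^γ}`. -/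
def mixedC {n : ℕ} (r β γ : ℝ) (v : Rn n → ℝ) : ℝ≥0∞ :=
  ⨆ Q : Cube n, ArQ r v Q ^ β * FWQ Q v ^ γ

/-- `Φ(t) = 1 + log t` applied to an `ℝ≥0∞` constant. -/
def PhiLog (X : ℝ≥0∞) : ℝ≥0∞ :=
  if X = ∞ then ∞ else ENNReal.ofReal (1 + Real.log X.toReal)

/-- A Young function. -/
def IsYoung (Φ : ℝ → ℝ) : Prop :=
  ContinuousOn Φ (Ici 0) ∧ ConvexOn ℝ (Ici 0) Φ ∧ StrictMonoOn Φ (Ici 0) ∧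
    Φ 0 = 0 ∧ Filter.Tendsto (fun t => Φ t / t) Filter.atTop Filter.atTop

/-- The associate (conjugate) Young function `Φ̄(t) = sup_{s>0} (st - Φ(s))`. -/
def assocFn (Φ : ℝ → ℝ) (t : ℝ) : ℝ :=
  sSup {y : ℝ | ∃ s : ℝ, 0 < s ∧ y = s * t - Φ s}

/-- The localized Luxemburg average `‖f‖_{Φ,Q}`. -/
def luxNorm {n : ℕ} (Φ : ℝ → ℝ) (Q : Cube n) (f : Rn n → ℝ) : ℝ≥0∞ :=
  sInf ((fun l : ℝ => ENNReal.ofReal l) ''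
    {l : ℝ | 0 < l ∧
      (∫⁻ x in Q.set, ENNReal.ofReal (Φ (|f x| / l))) ≤ ENNReal.ofReal Q.vol})

/-- The fractional Orlicz maximal operator `M_{β,Φ}`. -/
def orliczMax {n : ℕ} (β : ℝ) (Φ : ℝ → ℝ) (f : Rn n → ℝ) (x : Rn n) : ℝ≥0∞ :=
  ⨆ (Q : Cube n) (_ : x ∈ Q.set), ENNReal.ofReal (Q.vol ^ (β / n)) * luxNorm Φ Q f

/-- Unweighted `L^p` norm of a real function. -/
def Lp0 {n : ℕ} (f : Rn n → ℝ) (p : ℝ) : ℝ≥0∞ :=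
  (∫⁻ x, ENNReal.ofReal |f x| ^ p) ^ (1 / p)

/-- Unweighted `L^p` norm of an `ℝ≥0∞`-valued function. -/
def LpE {n : ℕ} (g : Rn n → ℝ≥0∞) (p : ℝ) : ℝ≥0∞ :=
  (∫⁻ x, g x ^ p) ^ (1 / p)

/-- The unweighted operator norm `‖M_{β,Φ}‖_{L^p → L^q}`. -/
def orliczMaxNorm (n : ℕ) (β : ℝ) (Φ : ℝ → ℝ) (p q : ℝ) : ℝ≥0∞ :=
  ⨆ (f : Rn n → ℝ) (_ : Measurable f), LpE (orliczMax β Φ f) q / Lp0 f p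

/-- The `B^β_p` integral `∫_c^∞ Φ(t)^{q/p} t^{-q} dt/t`, where `1/q = 1/p - β/n`. -/
def BInt (Φ : ℝ → ℝ) (p q : ℝ) (c : ℝ) : ℝ≥0∞ :=
  ∫⁻ t in Ioi c, ENNReal.ofReal (Φ t ^ (q / p) * t ^ (-q) / t)

/-- The `B^β_p` condition (with `q` given by `1/q = 1/p - β/n`). -/
def BCond (Φ : ℝ → ℝ) (p q : ℝ) : Prop := ∃ c : ℝ, 0 < c ∧ BInt Φ p q c < ∞

/-- The bump constant `[u,σ]_{A^α_{p,q,Φ}}`. -/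
def bumpA {n : ℕ} (α p q : ℝ) (Φ : ℝ → ℝ) (u σ : Rn n → ℝ) : ℝ≥0∞ :=
  ⨆ Q : Cube n,
    ENNReal.ofReal (Q.vol ^ (α / n + 1 / q - 1 / p)) * avgW Q u ^ (1 / q) *
      luxNorm Φ Q (fun x => σ x ^ (1 / conjExp p))

/-- A dyadic grid in `ℝ^n`. -/
def IsDyadicGrid {n : ℕ} (D : Set (Cube n)) : Prop :=
  (∀ Q ∈ D, ∃ k : ℤ, Q.side = (2 : ℝ) ^ k) ∧
  (∀ Q ∈ D, ∀ P ∈ D, Q.set ∩ P.set = P.set ∨ Q.set ∩ P.set = Q.set ∨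
    Q.set ∩ P.set = ∅) ∧
  (∀ k : ℤ, ∀ x : Rn n, ∃! Q : Cube n, Q ∈ D ∧ Q.side = (2 : ℝ) ^ k ∧ x ∈ Q.set)

/-- The outer dyadic Riesz potential `I_α^{Q₀}`. -/
def outerRiesz {n : ℕ} (D : Set (Cube n)) (α : ℝ) (Q₀ : Cube n)
    (f : Rn n → ℝ≥0∞) (x : Rn n) : ℝ≥0∞ :=
  ∑' Q : {Q : Cube n // Q ∈ D ∧ Q₀.set ⊆ Q.set},
    Q.1.set.indicator
      (fun _ => ENNReal.ofReal (Q.1.vol ^ (α / n - 1)) * ∫⁻ y in Q.1.set, f y) x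

/-- The outer testing constant `[u,σ]_{I_α^{out},p,q}`. -/
def outerTest {n : ℕ} (D : Set (Cube n)) (α p q : ℝ) (u σ : Rn n → ℝ) : ℝ≥0∞ :=
  ⨆ (Q₀ : Cube n) (_ : Q₀ ∈ D),
    (∫⁻ x, outerRiesz D α Q₀ (Q₀.set.indicator fun y => ENNReal.ofReal (σ y)) x ^ q *
        ENNReal.ofReal (u x)) ^ (1 / q) /
      (∫⁻ x in Q₀.set, ENNReal.ofReal (σ x)) ^ (1 / p)

/-- The dyadic fractional maximal operator `M_α^𝒟`. -/
def dyadicFracMax {n : ℕ} (D : Set (Cube n)) (α : ℝ) (f : Rn n → ℝ≥0∞)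
    (x : Rn n) : ℝ≥0∞ :=
  ⨆ (Q : Cube n) (_ : Q ∈ D) (_ : x ∈ Q.set),
    ENNReal.ofReal (Q.vol ^ (α / n - 1)) * ∫⁻ y in Q.set, f y

/-- A sparse family `S ⊆ D` with associated disjoint thick subsets `E Q ⊆ Q`. -/
def IsSparse {n : ℕ} (D S : Set (Cube n)) (E : Cube n → Set (Rn n)) : Prop :=
  S ⊆ D ∧
  (∀ Q ∈ S, E Q ⊆ Q.set ∧ MeasurableSet (E Q) ∧
    ENNReal.ofReal Q.vol ≤ 2 * volume (E Q)) ∧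
  S.PairwiseDisjoint E

/-- The sparse operator `L_α^S`. -/
def sparseOp {n : ℕ} (S : Set (Cube n)) (E : Cube n → Set (Rn n)) (α : ℝ)
    (f : Rn n → ℝ≥0∞) (x : Rn n) : ℝ≥0∞ :=
  ∑' Q : S,
    (E Q.1).indicator
      (fun _ => ENNReal.ofReal (Q.1.vol ^ (α / n - 1)) * ∫⁻ y in Q.1.set, f y) x

/-- The one-dimensional fractional maximal operator over bounded intervals. -/
def fm1 (γ : ℝ) (f : ℝ → ℝ≥0∞) (x : ℝ) : ℝ≥0∞ :=
  ⨆ (a : ℝ) (b : ℝ) (_ : a < b) (_ : x ∈ Icc a b),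
    ENNReal.ofReal ((b - a) ^ (γ - 1)) * ∫⁻ y in Ioo a b, f y

/-- In a measure without atoms, every mass level below the mass of a ball is attained by some
smaller concentric ball, up to the mass of the sphere. -/
lemma exists_radius_of_lt_measure_ball {X : Type*} [MetricSpace X] [MeasurableSpace X]
    [OpensMeasurableSpace X] (ν : Measure X) [NullSingletonClass ν]
    (hν : ∀ x r, ν (Metric.closedBall x r) ≠ ∞) {x : X} {L : ℝ} {s : ℝ≥0∞} (hs : s ≠ 0)
    (hL : s < ν (Metric.ball x L)) :
    ∃ r, 0 < r ∧ r ≤ L ∧ ν (Metric.ball x r) ≤ s ∧ s ≤ ν (Metric.closedBall x r) := by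
  set S : Set ℝ := {r | ν (Metric.ball x r) ≤ s} with hS
  have h0 : (0 : ℝ) ∈ S := by simp [hS]
  have hub : ∀ r ∈ S, r ≤ L := by
    intro r hr
    by_contra! hlt
    exact (hL.trans_le (measure_mono (Metric.ball_subset_ball hlt.le))).not_ge hr
  have hbdd : BddAbove S := ⟨L, hub⟩
  have hup : s ≤ ν (Metric.closedBall x (sSup S)) := by
    obtain ⟨v, hv, hvr, hvt⟩ := exists_seq_strictAnti_tendsto (sSup S)
    have hcb : Metric.closedBall x (sSup S) = ⋂ i, Metric.ball x (v i) := by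
      ext y
      simp only [Metric.mem_closedBall, mem_iInter, Metric.mem_ball]
      exact ⟨fun h i => h.trans_lt (hvr i), fun h => ge_of_tendsto' hvt fun i => (h i).le⟩
    rw [hcb, Antitone.measure_iInter
      (fun i j hij => Metric.ball_subset_ball (hv.antitone hij))
      (fun i => Metric.isOpen_ball.measurableSet.nullMeasurableSet)
      ⟨0, ne_top_of_le_ne_top (hν x (v 0)) (measure_mono Metric.ball_subset_closedBall)⟩]
    refine le_iInf fun i => ?_
    by_contra! hlt
    exact (hvr i).not_ge (le_csSup hbdd hlt.le)
  refine ⟨sSup S, ?_, csSup_le ⟨0, h0⟩ hub, ?_, hup⟩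
  · by_contra! hle
    have : ν (Metric.closedBall x (sSup S)) = 0 :=
      measure_mono_null ((Metric.closedBall_subset_closedBall hle).trans
        Metric.closedBall_zero.subset) (measure_singleton x)
    exact hs (le_antisymm (this ▸ hup) zero_le)
  · obtain ⟨v, hv, hvr, hvt⟩ := exists_seq_strictMono_tendsto (sSup S)
    have hb : Metric.ball x (sSup S) = ⋃ i, Metric.ball x (v i) := by
      ext y
      simp only [Metric.mem_ball, mem_iUnion]
      exact ⟨fun h => ((hvt.eventually (lt_mem_nhds h)).exists), fun ⟨i, h⟩ => h.trans (hvr i)⟩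
    rw [hb, Monotone.measure_iUnion
      (fun i j hij => Metric.ball_subset_ball (hv.monotone hij))]
    refine iSup_le fun i => ?_
    obtain ⟨r, hr, hir⟩ := exists_lt_of_lt_csSup ⟨0, h0⟩ (hvr i)
    exact (measure_mono (Metric.ball_subset_ball hir.le)).trans hr

/-- The sum of the geometric series arising from the decay of masses of nested balls. -/
def nestedBallConst (p q : ℝ) : ℝ := 2 ^ (1 / q) / (1 - 2 ^ (1 / q - 1 / p))

lemma nestedBallConst_pos {p q : ℝ} (hp : 0 < p) (hpq : p < q) : 0 < nestedBallConst p q := by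
  have h : (2 : ℝ) ^ (1 / q - 1 / p) < 1 :=
    Real.rpow_lt_one_of_one_lt_of_neg one_lt_two
      (sub_neg.2 (one_div_lt_one_div_of_lt hp hpq))
  exact div_pos (Real.rpow_pos_of_pos two_pos _) (by linarith)

/-- If the mass of `f ^ p` on small balls around `x` is dominated by their `ν`-mass, then the
potential of `f` at `x` is bounded. -/
lemma lintegral_kernel_le_of_ball_le {X : Type*} [MetricSpace X] [MeasurableSpace X]
    [OpensMeasurableSpace X] (μ ν : Measure X) [NullSingletonClass ν]
    (hν : ∀ x r, ν (Metric.closedBall x r) ≠ ∞) {p p' q κ F R L : ℝ}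
    (hpp : p.HolderConjugate p') (hpq : p < q) (hκ : 0 < κ) (hF : 0 < F) (hR : 0 < R)
    {x : X} {k f : X → ℝ≥0∞} (hk : Measurable k) (hk0 : k x = 0) (hf : Measurable f)
    (hK : ∀ r, 0 < r → ν (Metric.closedBall x r) ^ (1 / q) *
      (∫⁻ y in {y | r ≤ dist y x}, k y ^ p' ∂μ) ^ (1 / p') ≤ ENNReal.ofReal κ)
    (hfF : ∫⁻ y, f y ^ p ∂μ ≤ ENNReal.ofReal (F ^ p))
    (hx : x ∈ ν.support) (hL : ENNReal.ofReal R < ν (Metric.ball x L))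
    (hG : ∀ r, 0 < r → r ≤ L → ∫⁻ y in Metric.ball x r, f y ^ p ∂μ ≤
      ENNReal.ofReal ((F / nestedBallConst p q) ^ p / R) * ν (Metric.ball x r)) :
    ∫⁻ y, f y * k y ∂μ ≤ ENNReal.ofReal (2 * F * κ * R ^ (-(1 / q))) := by
  have hp0 : 0 < p := hpp.pos
  have hp'0 : 0 < p' := hpp.symm.pos
  have hq0 : 0 < q := hp0.trans hpq
  have hC := nestedBallConst_pos hp0 hpq
  have hs0 : ∀ j : ℕ, 0 < (1 / 2 : ℝ) ^ j * R := fun j => by positivity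
  have hsR : ∀ j : ℕ, (1 / 2 : ℝ) ^ j * R ≤ R := fun j =>
    mul_le_of_le_one_left hR.le (pow_le_one₀ (by norm_num) (by norm_num))
  have hrad := fun j : ℕ => exists_radius_of_lt_measure_ball ν hν (x := x) (L := L)
    (s := ENNReal.ofReal ((1 / 2 : ℝ) ^ j * R)) (by simpa using hs0 j)
    ((ENNReal.ofReal_le_ofReal (hsR j)).trans_lt hL)
  choose r hr0 hrL hrb hrc using hrad
  have hKr : ∀ j, (∫⁻ y in {y | r j ≤ dist y x}, k y ^ p' ∂μ) ^ (1 / p') ≤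
      ENNReal.ofReal (κ * ((1 / 2 : ℝ) ^ j * R) ^ (-(1 / q))) := by
    intro j
    have h1 : ENNReal.ofReal (((1 / 2 : ℝ) ^ j * R) ^ (1 / q)) *
        (∫⁻ y in {y | r j ≤ dist y x}, k y ^ p' ∂μ) ^ (1 / p') ≤ ENNReal.ofReal κ := by
      refine le_trans ?_ (hK (r j) (hr0 j))
      rw [← ENNReal.ofReal_rpow_of_pos (hs0 j)]
      gcongr
      exact hrc j
    have hpos : 0 < ((1 / 2 : ℝ) ^ j * R) ^ (1 / q) := Real.rpow_pos_of_pos (hs0 j) _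
    rw [Real.rpow_neg (hs0 j).le, ← div_eq_mul_inv, ENNReal.ofReal_div_of_pos hpos,
      ENNReal.le_div_iff_mul_le (Or.inl (ENNReal.ofReal_pos.2 hpos).ne') (by simp), mul_comm]
    exact h1
  have hcover : (univ : Set X) ⊆ {x} ∪ ({y | r 0 ≤ dist y x} ∪
      ⋃ j : ℕ, {y | r (j + 1) ≤ dist y x} ∩ Metric.ball x (r j)) := by
    intro y _
    by_cases hy : y = x
    · exact Or.inl hy
    right
    have hd : 0 < dist y x := dist_pos.2 hy
    have hex : ∃ j, r j ≤ dist y x := by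
      have hpos : 0 < ν (Metric.ball x (dist y x)) :=
        (Measure.mem_support_iff_forall x).1 hx _ (Metric.ball_mem_nhds x hd)
      obtain ⟨c, hc0, hc⟩ := ENNReal.lt_iff_exists_real_btwn.1 hpos
      have hc0' : 0 < c := by simpa using hc.1
      obtain ⟨j, hj⟩ := exists_pow_lt_of_lt_one (div_pos hc0' hR) (by norm_num : (1 / 2 : ℝ) < 1)
      refine ⟨j, ?_⟩
      by_contra! hlt
      have h1 := (measure_mono (Metric.ball_subset_ball hlt.le)).trans (hrb j)
      have h2 : ENNReal.ofReal ((1 / 2 : ℝ) ^ j * R) ≤ ENNReal.ofReal c :=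
        ENNReal.ofReal_le_ofReal ((lt_div_iff₀ hR).1 hj).le
      exact (hc.2.trans_le (h1.trans h2)).false
    classical
    rcases hn : Nat.find hex with _ | j
    · exact Or.inl (by simpa [hn] using Nat.find_spec hex)
    · refine Or.inr (mem_iUnion.2 ⟨j, by simpa [hn] using Nat.find_spec hex, ?_⟩)
      have := Nat.find_min hex (m := j) (by omega)
      simpa using this
  have houter : ∫⁻ y in {y | r 0 ≤ dist y x}, f y * k y ∂μ ≤
      ENNReal.ofReal (F * κ * R ^ (-(1 / q))) := by
    refine (ENNReal.lintegral_mul_le_Lp_mul_Lq _ hpp hf.aemeasurable hk.aemeasurable).trans ?_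
    rw [mul_assoc, ENNReal.ofReal_mul hF.le]
    refine mul_le_mul' ?_ (by simpa using hKr 0)
    calc _ ≤ (ENNReal.ofReal (F ^ p)) ^ (1 / p) := by
          gcongr
          exact (setLIntegral_le_lintegral _ _).trans hfF
      _ = ENNReal.ofReal F := by
          rw [ENNReal.ofReal_rpow_of_pos (by positivity), ← Real.rpow_mul hF.le,
            mul_one_div_cancel hp0.ne', Real.rpow_one]
  have hinner : ∀ j : ℕ, ∫⁻ y in {y | r (j + 1) ≤ dist y x} ∩ Metric.ball x (r j),
      f y * k y ∂μ ≤ ENNReal.ofReal (F / nestedBallConst p q * κ * R ^ (-(1 / q)) * 2 ^ (1 / q) *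
        (2 ^ (1 / q - 1 / p)) ^ j) := by
    intro j
    refine (ENNReal.lintegral_mul_le_Lp_mul_Lq _ hpp hf.aemeasurable hk.aemeasurable).trans ?_
    have h1 : (∫⁻ y in {y | r (j + 1) ≤ dist y x} ∩ Metric.ball x (r j), f y ^ p ∂μ) ^ (1 / p) ≤
        ENNReal.ofReal (F / nestedBallConst p q * ((1 / 2) ^ j) ^ (1 / p)) := by
      calc _ ≤ (ENNReal.ofReal ((F / nestedBallConst p q) ^ p / R) *
            ENNReal.ofReal ((1 / 2 : ℝ) ^ j * R)) ^ (1 / p) := by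
            gcongr
            refine (lintegral_mono_set inter_subset_right).trans ((hG _ (hr0 j) (hrL j)).trans ?_)
            gcongr
            exact hrb j
        _ = _ := by
            rw [← ENNReal.ofReal_mul (by positivity), ENNReal.ofReal_rpow_of_pos (by positivity)]
            congr 1
            rw [show (F / nestedBallConst p q) ^ p / R * ((1 / 2 : ℝ) ^ j * R) =
              (F / nestedBallConst p q) ^ p * (1 / 2 : ℝ) ^ j by field_simp,
              Real.mul_rpow (by positivity) (by positivity), ← Real.rpow_mul (by positivity),
              mul_one_div_cancel hp0.ne', Real.rpow_one]
    have h2 : (∫⁻ y in {y | r (j + 1) ≤ dist y x} ∩ Metric.ball x (r j), k y ^ p' ∂μ) ^ (1 / p') ≤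
        ENNReal.ofReal (κ * ((1 / 2 : ℝ) ^ (j + 1) * R) ^ (-(1 / q))) := by
      refine le_trans ?_ (hKr (j + 1))
      gcongr
      exact inter_subset_left
    refine (mul_le_mul' h1 h2).trans ?_
    rw [← ENNReal.ofReal_mul (by positivity)]
    refine ENNReal.ofReal_le_ofReal (le_of_eq ?_)
    have hhalf : ∀ (m : ℕ) (e : ℝ), ((1 / 2 : ℝ) ^ m) ^ e = 2 ^ (-(m * e)) := by
      intro m e
      rw [one_div, inv_pow, Real.inv_rpow (by positivity), Real.rpow_neg (by positivity),
        ← Real.rpow_natCast, ← Real.rpow_mul (by positivity)]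
    rw [Real.mul_rpow (by positivity) hR.le, hhalf, hhalf, ← Real.rpow_natCast,
      ← Real.rpow_mul (by positivity)]
    have : (2 : ℝ) ^ (-(j * (1 / p))) * 2 ^ (-(((j + 1 : ℕ) : ℝ) * -(1 / q))) =
        2 ^ (1 / q) * 2 ^ ((1 / q - 1 / p) * j) := by
      rw [← Real.rpow_add two_pos, ← Real.rpow_add two_pos]
      congr 1
      push_cast
      ring
    linear_combination (F / nestedBallConst p q * κ * R ^ (-(1 / q))) * this
  have hθ : (2 : ℝ) ^ (1 / q - 1 / p) < 1 :=
    Real.rpow_lt_one_of_one_lt_of_neg one_lt_two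
      (sub_neg.2 (one_div_lt_one_div_of_lt hp0 hpq))
  have hsum : ∑' j : ℕ, ENNReal.ofReal (F / nestedBallConst p q * κ * R ^ (-(1 / q)) *
      2 ^ (1 / q) * (2 ^ (1 / q - 1 / p)) ^ j) = ENNReal.ofReal (F * κ * R ^ (-(1 / q))) := by
    rw [← ENNReal.ofReal_tsum_of_nonneg (fun j => by positivity)
      ((summable_geometric_of_lt_one (by positivity) hθ).mul_left _), tsum_mul_left,
      tsum_geometric_of_lt_one (by positivity) hθ]
    congr 1
    have h1 : (1 - (2 : ℝ) ^ (1 / q - 1 / p)) ≠ 0 := by linarith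
    have h2 : (2 : ℝ) ^ (1 / q) ≠ 0 := by positivity
    rw [nestedBallConst, div_div_eq_mul_div]
    generalize (2 : ℝ) ^ (1 / q - 1 / p) = b at h1
    field_simp
  have hzero : ∫⁻ y in {x}, f y * k y ∂μ = 0 := by
    rw [lintegral_singleton, hk0]
    simp
  calc ∫⁻ y, f y * k y ∂μ = ∫⁻ y in univ, f y * k y ∂μ := by simp
    _ ≤ _ := lintegral_mono_set hcover
    _ ≤ _ := lintegral_union_le _ _ _
    _ ≤ 0 + (ENNReal.ofReal (F * κ * R ^ (-(1 / q))) +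
          ENNReal.ofReal (F * κ * R ^ (-(1 / q)))) := by
        refine add_le_add hzero.le ((lintegral_union_le _ _ _).trans (add_le_add houter ?_))
        exact (lintegral_iUnion_le _ _).trans ((ENNReal.tsum_le_tsum hinner).trans hsum.le)
    _ = _ := by
        rw [zero_add, ← ENNReal.ofReal_add (by positivity) (by positivity)]
        congr 1
        ring

/-- A Gabidzashvili–Kokilashvili type criterion: a testing condition on the tails of the kernel
implies an off-diagonal weak type estimate. -/
lemma measure_superlevel_kernel_le {X : Type*} [MetricSpace X] [SecondCountableTopology X]
    [MeasurableSpace X] [OpensMeasurableSpace X] {N : ℕ} {τ : ℝ} (hτ : 1 < τ)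
    (hN : IsEmpty (Besicovitch.SatelliteConfig X N τ)) (μ ν : Measure X) [NullSingletonClass ν]
    (hν : ∀ x r, ν (Metric.closedBall x r) ≠ ∞) {p p' q κ F R : ℝ}
    (hpp : p.HolderConjugate p') (hpq : p < q) (hκ : 0 < κ) (hF : 0 < F) (hR : 0 < R)
    {k : X → X → ℝ≥0∞} {f : X → ℝ≥0∞} (hk : ∀ x, Measurable (k x)) (hk0 : ∀ x, k x x = 0)
    (hf : Measurable f)
    (hK : ∀ x r, 0 < r → ν (Metric.closedBall x r) ^ (1 / q) *
      (∫⁻ y in {y | r ≤ dist y x}, k x y ^ p' ∂μ) ^ (1 / p') ≤ ENNReal.ofReal κ)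
    (hfF : ∫⁻ y, f y ^ p ∂μ ≤ ENNReal.ofReal (F ^ p)) :
    ν {x | ENNReal.ofReal (2 * F * κ * R ^ (-(1 / q))) < ∫⁻ y, f y * k x y ∂μ} ≤
      ENNReal.ofReal ((1 + N * nestedBallConst p q ^ p) * R) := by
  set E := {x | ENNReal.ofReal (2 * F * κ * R ^ (-(1 / q))) < ∫⁻ y, f y * k x y ∂μ}
  have hp0 : 0 < p := hpp.pos
  have hC := nestedBallConst_pos hp0 hpq
  have hle : ENNReal.ofReal R ≤ ENNReal.ofReal ((1 + N * nestedBallConst p q ^ p) * R) := by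
    refine ENNReal.ofReal_le_ofReal (le_mul_of_one_le_left hR.le ?_)
    have : (0 : ℝ) ≤ N * nestedBallConst p q ^ p := by positivity
    linarith
  rcases isEmpty_or_nonempty X with hX | ⟨⟨o⟩⟩
  · simp [Set.eq_empty_of_isEmpty E]
  have hexh : ∀ s : Set X, ν s = ⨆ m : ℕ, ν (s ∩ Metric.ball o m) := by
    intro s
    rw [← Monotone.measure_iUnion, ← inter_iUnion, Metric.iUnion_ball_nat, inter_univ]
    exact fun i j hij => inter_subset_inter_right _
      (Metric.ball_subset_ball (by exact_mod_cast hij))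
  by_cases huniv : ν univ ≤ ENNReal.ofReal R
  · exact (measure_mono (subset_univ _)).trans (huniv.trans hle)
  push Not at huniv
  rw [hexh univ] at huniv
  obtain ⟨m, hm⟩ := lt_iSup_iff.1 huniv
  rw [univ_inter] at hm
  set a : ℝ := (F / nestedBallConst p q) ^ p / R with ha
  have ha0 : 0 < a := by positivity
  rw [hexh E]
  refine iSup_le fun M => ?_
  have hnull : ν (E ∩ Metric.ball o M) ≤ ν (E ∩ Metric.ball o M ∩ ν.support) := by
    refine (measure_le_inter_add_sdiff ν _ ν.support).trans ?_
    rw [measure_mono_null (s := _ \ ν.support) (fun y hy => hy.2)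
      Measure.measure_compl_support, add_zero]
  refine hnull.trans ?_
  have hball : ∀ x : ↥(E ∩ Metric.ball o M ∩ ν.support), ∃ r, 0 < r ∧ r ≤ (m + M : ℝ) ∧
      ENNReal.ofReal a * ν (Metric.ball (x : X) r) < ∫⁻ y in Metric.ball (x : X) r, f y ^ p ∂μ := by
    rintro ⟨x, ⟨hxE, hxM⟩, hxs⟩
    by_contra! hcon
    refine (lt_irrefl _ (hxE.trans_le (lintegral_kernel_le_of_ball_le μ ν hν hpp hpq hκ hF hR
      (hk x) (hk0 x) hf (hK x) hfF hxs (hm.trans_le (measure_mono ?_)) hcon)))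
    refine Metric.ball_subset_ball' ?_
    have := Metric.mem_ball'.1 hxM
    linarith
  choose r hr0 hrL hr using hball
  obtain ⟨s, hsd, hsc⟩ := Besicovitch.exist_disjoint_covering_families hτ hN
    { c := fun x : ↥(E ∩ Metric.ball o M ∩ ν.support) => (x : X)
      r := r
      rpos := hr0
      r_bound := m + M
      r_le := hrL }
  simp only [Subtype.range_coe_subtype, ofPred_mem_eq] at hsc hsd
  have hfam : ∀ i, ν (⋃ j ∈ s i, Metric.ball (j : X) (r j)) ≤
      ENNReal.ofReal (nestedBallConst p q ^ p * R) := by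
    intro i
    have hdis : (s i).PairwiseDisjoint fun j => Metric.ball (j : X) (r j) :=
      (hsd i).mono fun j => Metric.ball_subset_closedBall
    have hcount : (s i).Countable :=
      hdis.countable_of_isOpen (fun j _ => Metric.isOpen_ball)
        fun j _ => Metric.nonempty_ball.2 (hr0 j)
    have h1 : ENNReal.ofReal a * ν (⋃ j ∈ s i, Metric.ball (j : X) (r j)) ≤
        ENNReal.ofReal (F ^ p) := by
      rw [measure_biUnion hcount hdis fun j _ => Metric.isOpen_ball.measurableSet,
        ← ENNReal.tsum_mul_left]
      refine (ENNReal.tsum_le_tsum fun j : s i => (hr j).le).trans ?_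
      rw [← lintegral_biUnion hcount (fun j _ => Metric.isOpen_ball.measurableSet) hdis]
      exact (setLIntegral_le_lintegral _ _).trans hfF
    have h2 : nestedBallConst p q ^ p * R = F ^ p / a := by
      rw [ha, Real.div_rpow hF.le hC.le]
      field_simp
    rw [h2, ENNReal.ofReal_div_of_pos ha0, ENNReal.le_div_iff_mul_le (by simp [ha0]) (by simp),
      mul_comm]
    exact h1
  calc ν (E ∩ Metric.ball o M ∩ ν.support)
      ≤ ν (⋃ i, ⋃ j ∈ s i, Metric.ball (j : X) (r j)) := measure_mono hsc
    _ ≤ ∑ i, ν (⋃ j ∈ s i, Metric.ball (j : X) (r j)) := measure_iUnion_fintype_le _ _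
    _ ≤ ∑ _i : Fin N, ENNReal.ofReal (nestedBallConst p q ^ p * R) :=
        Finset.sum_le_sum fun i _ => hfam i
    _ = ENNReal.ofReal (N * (nestedBallConst p q ^ p * R)) := by
        rw [Finset.sum_const, Finset.card_univ, Fintype.card_fin, nsmul_eq_mul,
          ENNReal.ofReal_mul (Nat.cast_nonneg N), ENNReal.ofReal_natCast]
    _ ≤ _ := ENNReal.ofReal_le_ofReal (by nlinarith)

lemma Cube.set_eq_pi {n : ℕ} (Q : Cube n) :
    Q.set = Set.pi univ fun i => Ico (Q.corner i) (Q.corner i + Q.side) := by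
  ext x
  simp [Cube.set]

lemma Cube.measurableSet_set {n : ℕ} (Q : Cube n) : MeasurableSet Q.set := by
  rw [Q.set_eq_pi]
  exact MeasurableSet.univ_pi fun i => measurableSet_Ico

lemma Cube.vol_pos {n : ℕ} (Q : Cube n) : 0 < Q.vol := pow_pos Q.side_pos n

lemma Cube.volume_set {n : ℕ} (Q : Cube n) : volume Q.set = ENNReal.ofReal Q.vol := by
  rw [Q.set_eq_pi, Real.volume_pi_Ico]
  simp [Cube.vol, ENNReal.ofReal_pow Q.side_pos.le]

/-- The cube with a given center and half side length. -/
def centeredCube {n : ℕ} (x : Rn n) (ρ : ℝ) (hρ : 0 < ρ) : Cube n where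
  corner := fun i => x i - ρ
  side := 2 * ρ
  side_pos := by positivity

lemma ball_subset_centeredCube {n : ℕ} (x : Rn n) {ρ : ℝ} (hρ : 0 < ρ) :
    Metric.ball x ρ ⊆ (centeredCube x ρ hρ).set := by
  intro y hy i
  have h := abs_lt.1 ((Real.dist_eq _ _ ▸ dist_le_pi_dist y x i).trans_lt hy)
  simp only [centeredCube]
  constructor <;> linarith [h.1, h.2]

lemma centeredCube_mono {n : ℕ} (x : Rn n) {ρ ρ' : ℝ} (hρ : 0 < ρ) (h : ρ ≤ ρ') :
    (centeredCube x ρ hρ).set ⊆ (centeredCube x ρ' (hρ.trans_le h)).set := by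
  intro y hy i
  have := hy i
  simp only [centeredCube] at this ⊢
  constructor <;> linarith [this.1, this.2]

/-- Doubling a cube at least doubles its volume. -/
lemma vol_centeredCube_le {n : ℕ} (hn : 0 < n) (x : Rn n) {ρ : ℝ} (hρ : 0 < ρ) :
    2 * (centeredCube x ρ hρ).vol ≤ (centeredCube x (2 * ρ) (by positivity)).vol := by
  simp only [Cube.vol, centeredCube]
  rw [mul_pow 2 (2 * ρ)]
  gcongr
  exact le_self_pow₀ one_le_two hn.ne'

lemma volume_le_two_mul_shell {n : ℕ} (hn : 0 < n) (x : Rn n) {ρ : ℝ} (hρ : 0 < ρ) :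
    ENNReal.ofReal (centeredCube x (2 * ρ) (by positivity)).vol ≤
      2 * volume ((centeredCube x (2 * ρ) (by positivity)).set \ (centeredCube x ρ hρ).set) := by
  rw [measure_sdiff (centeredCube_mono x hρ (by linarith))
    (Cube.measurableSet_set _).nullMeasurableSet (by simp [Cube.volume_set]),
    Cube.volume_set, Cube.volume_set, ← ENNReal.ofReal_sub _ (Cube.vol_pos _).le,
    ← ENNReal.ofReal_ofNat, ← ENNReal.ofReal_mul (by norm_num)]
  exact ENNReal.ofReal_le_ofReal (by linarith [vol_centeredCube_le hn x hρ])

/-- Young's inequality. -/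
lemma IsYoung.mul_le {Ψ : ℝ → ℝ} (hΨ : IsYoung Ψ) {s t : ℝ} (hs : 0 < s) (ht : 0 ≤ t) :
    s * t ≤ Ψ s + assocFn Ψ t := by
  obtain ⟨-, -, hmono, h0, hlim⟩ := hΨ
  have hbdd : BddAbove {y : ℝ | ∃ s : ℝ, 0 < s ∧ y = s * t - Ψ s} := by
    obtain ⟨S, hS⟩ := Filter.eventually_atTop.1 (hlim.eventually_ge_atTop t)
    refine ⟨max S 0 * t, ?_⟩
    rintro y ⟨s, hs, rfl⟩
    rcases le_total s S with h | h
    · have : 0 ≤ Ψ s := h0 ▸ hmono.monotoneOn self_mem_Ici hs.le hs.le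
      have : s * t ≤ max S 0 * t := by
        gcongr
        exact h.trans (le_max_left _ _)
      linarith
    · have h1 := (le_div_iff₀ hs).1 (hS s h)
      have : 0 ≤ max S 0 * t := by positivity
      linarith
  have := le_csSup hbdd ⟨s, hs, rfl⟩
  unfold assocFn
  linarith

lemma lintegral_le_luxNorm_mul {n : ℕ} {Φ : ℝ → ℝ} {c : ℝ} (hΦ : ∀ t, 0 ≤ t → t ≤ Φ t + c)
    (Q : Cube n) (f : Rn n → ℝ) :
    ∫⁻ x in Q.set, ENNReal.ofReal |f x| ≤
      luxNorm Φ Q f * (ENNReal.ofReal Q.vol * (1 + ENNReal.ofReal c)) := by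
  have hV : ENNReal.ofReal Q.vol ≠ 0 := by simpa using Q.vol_pos
  rw [← ENNReal.div_le_iff (mul_ne_zero hV (by simp))
    (ENNReal.mul_ne_top ENNReal.ofReal_ne_top (by simp))]
  refine le_sInf ?_
  rintro _ ⟨l, ⟨hl, hlQ⟩, rfl⟩
  refine ENNReal.div_le_of_le_mul ?_
  calc ∫⁻ x in Q.set, ENNReal.ofReal |f x|
      ≤ ∫⁻ x in Q.set, ENNReal.ofReal l *
          (ENNReal.ofReal (Φ (|f x| / l)) + ENNReal.ofReal c) := by
        refine lintegral_mono fun x => ?_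
        have h := hΦ (|f x| / l) (by positivity)
        calc ENNReal.ofReal |f x| = ENNReal.ofReal l * ENNReal.ofReal (|f x| / l) := by
              rw [← ENNReal.ofReal_mul hl.le, mul_div_cancel₀ _ hl.ne']
          _ ≤ _ := by
              gcongr
              exact (ENNReal.ofReal_le_ofReal h).trans ENNReal.ofReal_add_le
    _ = ENNReal.ofReal l * ((∫⁻ x in Q.set, ENNReal.ofReal (Φ (|f x| / l))) +
          ENNReal.ofReal c * ENNReal.ofReal Q.vol) := by
        rw [lintegral_const_mul' _ _ ENNReal.ofReal_ne_top,
          lintegral_add_right _ measurable_const, setLIntegral_const, Q.volume_set]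
    _ ≤ ENNReal.ofReal l * (ENNReal.ofReal Q.vol + ENNReal.ofReal c * ENNReal.ofReal Q.vol) := by
        gcongr
    _ = _ := by ring

/-- The generalized Hölder inequality for Luxemburg averages. -/
lemma lintegral_mul_le_luxNorm_mul_luxNorm {n : ℕ} {Ψ : ℝ → ℝ} (hΨ : IsYoung Ψ) (Q : Cube n)
    {f g : Rn n → ℝ} (hf : Measurable f) (hg : Measurable g) :
    ∫⁻ x in Q.set, ENNReal.ofReal (|f x| * |g x|) ≤
      2 * ENNReal.ofReal Q.vol * luxNorm Ψ Q f * luxNorm (assocFn Ψ) Q g := by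
  obtain ⟨hcont, -, -, h0, -⟩ := id hΨ
  have hV : ENNReal.ofReal Q.vol ≠ 0 := by simpa using Q.vol_pos
  have hzero : ∀ {φ ψ : Rn n → ℝ}, Measurable φ → (∫⁻ x in Q.set, ENNReal.ofReal |φ x|) = 0 →
      ∫⁻ x in Q.set, ENNReal.ofReal (|φ x| * |ψ x|) = 0 := by
    intro φ ψ hφ h
    have hae := (lintegral_eq_zero_iff (by fun_prop)).1 h
    refine lintegral_eq_zero_of_ae_eq_zero ?_
    filter_upwards [hae] with x hx
    have : φ x = 0 := by simpa using hx
    simp [this]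
  by_cases hf0 : luxNorm Ψ Q f = 0
  · refine (hzero hf (le_antisymm ((lintegral_le_luxNorm_mul (Φ := Ψ) (c := |assocFn Ψ 1|)
      ?_ Q f).trans (by simp [hf0])) zero_le)).trans_le zero_le
    intro t ht
    rcases ht.eq_or_lt with rfl | ht
    · rw [h0]
      positivity
    · have := hΨ.mul_le ht zero_le_one
      linarith [le_abs_self (assocFn Ψ 1)]
  by_cases hg0 : luxNorm (assocFn Ψ) Q g = 0
  · simp_rw [mul_comm |f _|]
    refine (hzero hg (le_antisymm ((lintegral_le_luxNorm_mul (Φ := assocFn Ψ) (c := Ψ 1)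
      ?_ Q g).trans (by simp [hg0])) zero_le)).trans_le zero_le
    intro t ht
    linarith [hΨ.mul_le one_pos ht]
  by_cases hft : luxNorm Ψ Q f = ∞
  · simp [hft, hV, hg0]
  have hadm : ∀ l m : ℝ, 0 < l → 0 < m →
      (∫⁻ x in Q.set, ENNReal.ofReal (Ψ (|f x| / l))) ≤ ENNReal.ofReal Q.vol →
      (∫⁻ x in Q.set, ENNReal.ofReal (assocFn Ψ (|g x| / m))) ≤ ENNReal.ofReal Q.vol →
      ∫⁻ x in Q.set, ENNReal.ofReal (|f x| * |g x|) ≤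
        2 * ENNReal.ofReal Q.vol * ENNReal.ofReal l * ENNReal.ofReal m := by
    intro l m hl hm hfl hgm
    have hmeas : Measurable fun x => ENNReal.ofReal (Ψ (|f x| / l)) := by
      have hc : Continuous fun t => Ψ (max t 0) :=
        hcont.comp_continuous (by fun_prop) fun t => mem_Ici.2 (le_max_right _ _)
      have : (fun x => ENNReal.ofReal (Ψ (|f x| / l))) =
          fun x => ENNReal.ofReal (Ψ (max (|f x| / l) 0)) := by
        ext x
        rw [max_eq_left (by positivity)]
      rw [this]
      exact (hc.measurable.comp (by fun_prop)).ennreal_ofReal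
    calc ∫⁻ x in Q.set, ENNReal.ofReal (|f x| * |g x|)
        ≤ ∫⁻ x in Q.set, ENNReal.ofReal (l * m) *
          (ENNReal.ofReal (Ψ (|f x| / l)) + ENNReal.ofReal (assocFn Ψ (|g x| / m))) := by
          refine lintegral_mono fun x => ?_
          rcases (abs_nonneg (f x)).eq_or_lt with h | h
          · simp [← h]
          have hy := hΨ.mul_le (s := |f x| / l) (t := |g x| / m) (by positivity) (by positivity)
          calc ENNReal.ofReal (|f x| * |g x|)
              = ENNReal.ofReal (l * m) * ENNReal.ofReal (|f x| / l * (|g x| / m)) := by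
                rw [← ENNReal.ofReal_mul (by positivity)]
                congr 1
                field_simp
            _ ≤ _ := by
                gcongr
                exact (ENNReal.ofReal_le_ofReal hy).trans ENNReal.ofReal_add_le
      _ = ENNReal.ofReal (l * m) * ((∫⁻ x in Q.set, ENNReal.ofReal (Ψ (|f x| / l))) +
          ∫⁻ x in Q.set, ENNReal.ofReal (assocFn Ψ (|g x| / m))) := by
          rw [lintegral_const_mul' _ _ ENNReal.ofReal_ne_top, lintegral_add_left hmeas]
      _ ≤ ENNReal.ofReal (l * m) * (ENNReal.ofReal Q.vol + ENNReal.ofReal Q.vol) := by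
          gcongr
      _ = _ := by
          rw [ENNReal.ofReal_mul hl.le]
          ring
  have hc1 : 2 * ENNReal.ofReal Q.vol * luxNorm Ψ Q f ≠ 0 :=
    mul_ne_zero (mul_ne_zero two_ne_zero hV) hf0
  have hc2 : 2 * ENNReal.ofReal Q.vol * luxNorm Ψ Q f ≠ ∞ :=
    ENNReal.mul_ne_top (ENNReal.mul_ne_top (by simp) ENNReal.ofReal_ne_top) hft
  rw [← ENNReal.div_le_iff' hc1 hc2]
  refine le_sInf ?_
  rintro _ ⟨m, ⟨hm, hgm⟩, rfl⟩
  rw [ENNReal.div_le_iff' hc1 hc2, mul_right_comm]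
  have hm0 : ENNReal.ofReal m ≠ 0 := by simpa using hm
  have hd1 : 2 * ENNReal.ofReal Q.vol * ENNReal.ofReal m ≠ 0 :=
    mul_ne_zero (mul_ne_zero two_ne_zero hV) hm0
  have hd2 : 2 * ENNReal.ofReal Q.vol * ENNReal.ofReal m ≠ ∞ :=
    ENNReal.mul_ne_top (ENNReal.mul_ne_top (by simp) ENNReal.ofReal_ne_top) ENNReal.ofReal_ne_top
  rw [← ENNReal.div_le_iff' hd1 hd2]
  refine le_sInf ?_
  rintro _ ⟨l, ⟨hl, hfl⟩, rfl⟩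
  rw [ENNReal.div_le_iff' hd1 hd2, mul_right_comm]
  exact hadm l m hl hm hfl hgm

lemma conjExp_conjExp {q : ℝ} (hq : 1 < q) : conjExp (conjExp q) = q := by
  have h : q - 1 ≠ 0 := by linarith
  unfold conjExp
  field_simp
  ring

lemma holderConjugate_conjExp {q : ℝ} (hq : 1 < q) : q.HolderConjugate (conjExp q) :=
  Real.HolderConjugate.conjExponent hq

/-- The bump condition bounds the mass of a set times the average of `σ` on a larger cube by the
Orlicz maximal function of a power of `u`. -/
lemma rpow_mul_lintegral_le_lintegral_orliczMax {n : ℕ} (hn : 0 < n) {α p q : ℝ} (hα : 0 < α)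
    (hp : 1 < p) (hpq : p < q) {Ψ : ℝ → ℝ} (hΨ : IsYoung Ψ) {u σ : Rn n → ℝ}
    (hu : Measurable u) (hu0 : ∀ x, 0 ≤ u x) (x : Rn n) {ρ : ℝ} (hρ : 0 < ρ)
    {B : Set (Rn n)} (hB : MeasurableSet B) (hBQ : B ⊆ (centeredCube x (2 * ρ) (by positivity)).set) :
    (ENNReal.ofReal (ρ ^ (α - n)) * ∫⁻ y in B, ENNReal.ofReal (u y)) ^ conjExp p *
        (∫⁻ y in (centeredCube x (2 * ρ) (by positivity)).set, ENNReal.ofReal (σ y)) ≤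
      2 * (2 * 4 ^ n * bumpA α (conjExp q) (conjExp p) Ψ σ u) ^ conjExp p *
        ∫⁻ y in (centeredCube x (2 * ρ) (by positivity)).set \ (centeredCube x ρ hρ).set,
          orliczMax (n * (1 / p - 1 / q)) (assocFn Ψ)
            (B.indicator fun y => u y ^ (1 / conjExp q)) y ^ conjExp p := by
  have hq : 1 < q := hp.trans hpq
  have hpp := holderConjugate_conjExp hp
  have hqq := holderConjugate_conjExp hq
  have hp' : 0 < conjExp p := hpp.symm.pos
  have hn0 : (n : ℝ) ≠ 0 := by exact_mod_cast hn.ne'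
  have hpinv : 1 / conjExp p = 1 - 1 / p := by
    rw [one_div, one_div]
    exact eq_sub_of_add_eq' hpp.inv_add_inv_eq_one
  have hqinv : 1 / conjExp q = 1 - 1 / q := by
    rw [one_div, one_div]
    exact eq_sub_of_add_eq' hqq.inv_add_inv_eq_one
  set Q := centeredCube x (2 * ρ) (by positivity) with hQ
  set h : Rn n → ℝ := B.indicator fun y => u y ^ (1 / conjExp q) with hh
  set A := bumpA α (conjExp q) (conjExp p) Ψ σ u
  set b := ∫⁻ y in B, ENNReal.ofReal (u y) with hb
  set s := ∫⁻ y in Q.set, ENNReal.ofReal (σ y)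
  set V := Q.vol with hVdef
  have hV : 0 < V := Q.vol_pos
  have hV4 : V = (4 * ρ) ^ n := by
    simp only [hVdef, hQ, Cube.vol, centeredCube]
    ring
  have hVpow : ∀ e : ℝ, V ^ e = (4 * ρ) ^ (n * e) := by
    intro e
    rw [hV4, ← Real.rpow_natCast, ← Real.rpow_mul (by positivity)]
  set g : Rn n → ℝ := fun y => u y ^ (1 / q) with hg
  have hholder : b ≤ 2 * ENNReal.ofReal V * luxNorm Ψ Q g * luxNorm (assocFn Ψ) Q h := by
    refine le_trans ?_ (lintegral_mul_le_luxNorm_mul_luxNorm hΨ Q (f := g) (g := h)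
      (hu.pow_const _) ((hu.pow_const _).indicator hB))
    calc b = ∫⁻ y in B, ENNReal.ofReal (|g y| * |h y|) := by
          refine setLIntegral_congr_fun hB fun y hy => ?_
          have h1 : h y = u y ^ (1 / conjExp q) := indicator_of_mem hy _
          simp only [h1, hg]
          rw [abs_of_nonneg (Real.rpow_nonneg (hu0 y) _), abs_of_nonneg (Real.rpow_nonneg (hu0 y) _),
            hqinv]
          rcases (hu0 y).eq_or_lt with h0 | h0
          · rw [← h0, Real.zero_rpow (by positivity), zero_mul]
          · rw [← Real.rpow_add h0, add_sub_cancel, Real.rpow_one]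
      _ ≤ _ := lintegral_mono_set hBQ
  have hbump : ENNReal.ofReal (V ^ (α / n + 1 / q - 1 / p)) *
      (s / ENNReal.ofReal V) ^ (1 / conjExp p) * luxNorm Ψ Q g ≤ A := by
    have := le_iSup (fun Q : Cube n =>
      ENNReal.ofReal (Q.vol ^ (α / n + 1 / conjExp p - 1 / conjExp q)) *
        avgW Q σ ^ (1 / conjExp p) *
        luxNorm Ψ Q (fun x => u x ^ (1 / conjExp (conjExp q)))) Q
    refine le_trans (le_of_eq ?_) this
    rw [conjExp_conjExp hq, hpinv, hqinv]
    congr 4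
    ring
  set m := ENNReal.ofReal (V ^ (1 / p - 1 / q)) * luxNorm (assocFn Ψ) Q h with hm
  have hmle : ∀ y ∈ Q.set, m ≤ orliczMax (n * (1 / p - 1 / q)) (assocFn Ψ) h y := by
    intro y hy
    refine le_trans (le_of_eq ?_) (le_iSup₂ (f := fun (Q : Cube n) (_ : y ∈ Q.set) =>
      ENNReal.ofReal (Q.vol ^ (n * (1 / p - 1 / q) / n)) * luxNorm (assocFn Ψ) Q h) Q hy)
    rw [mul_div_cancel_left₀ _ hn0]
  have hkey : ENNReal.ofReal (ρ ^ (α - n)) * b * s ^ (1 / conjExp p) ≤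
      2 * 4 ^ n * A * ENNReal.ofReal V ^ (1 / conjExp p) * m := by
    have hρV : ENNReal.ofReal (ρ ^ (α - n)) * ENNReal.ofReal V ≤ 4 ^ n *
        (ENNReal.ofReal (V ^ (1 / p - 1 / q)) * ENNReal.ofReal (V ^ (α / n + 1 / q - 1 / p))) := by
      rw [← ENNReal.ofReal_mul (by positivity), ← ENNReal.ofReal_mul (by positivity),
        ← Real.rpow_add hV, show (4 : ℝ≥0∞) ^ n = ENNReal.ofReal (4 ^ n) by
          rw [ENNReal.ofReal_pow (by norm_num)]; norm_num,
        ← ENNReal.ofReal_mul (by positivity)]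
      refine ENNReal.ofReal_le_ofReal ?_
      rw [hVpow, show n * (1 / p - 1 / q + (α / n + 1 / q - 1 / p)) = α by field_simp; ring,
        hV4, mul_pow, Real.mul_rpow (by norm_num) hρ.le, Real.rpow_sub hρ, Real.rpow_natCast]
      have h4 : (1 : ℝ) ≤ 4 ^ α := Real.one_le_rpow (by norm_num) hα.le
      calc ρ ^ α / ρ ^ n * (4 ^ n * ρ ^ n) = 4 ^ n * (1 * ρ ^ α) := by field_simp
        _ ≤ _ := by gcongr
    have hsV : s ^ (1 / conjExp p) =
        ENNReal.ofReal V ^ (1 / conjExp p) * (s / ENNReal.ofReal V) ^ (1 / conjExp p) := by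
      rw [← ENNReal.mul_rpow_of_nonneg _ _ (by positivity),
        ENNReal.mul_div_cancel (by simpa using hV) ENNReal.ofReal_ne_top]
    calc ENNReal.ofReal (ρ ^ (α - n)) * b * s ^ (1 / conjExp p)
        ≤ ENNReal.ofReal (ρ ^ (α - n)) *
          (2 * ENNReal.ofReal V * luxNorm Ψ Q g * luxNorm (assocFn Ψ) Q h) *
          s ^ (1 / conjExp p) := by gcongr
      _ = 2 * (ENNReal.ofReal (ρ ^ (α - n)) * ENNReal.ofReal V) *
          luxNorm Ψ Q g * luxNorm (assocFn Ψ) Q h * s ^ (1 / conjExp p) := by ring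
      _ ≤ 2 * (4 ^ n * (ENNReal.ofReal (V ^ (1 / p - 1 / q)) *
            ENNReal.ofReal (V ^ (α / n + 1 / q - 1 / p)))) *
          luxNorm Ψ Q g * luxNorm (assocFn Ψ) Q h * s ^ (1 / conjExp p) := by gcongr
      _ = 2 * 4 ^ n * (ENNReal.ofReal (V ^ (α / n + 1 / q - 1 / p)) *
          (s / ENNReal.ofReal V) ^ (1 / conjExp p) * luxNorm Ψ Q g) *
          ENNReal.ofReal V ^ (1 / conjExp p) * m := by
          rw [hsV, hm]
          ring
      _ ≤ _ := by gcongr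
  have hpow : ∀ z : ℝ≥0∞, (z ^ (1 / conjExp p)) ^ conjExp p = z := by
    intro z
    rw [← ENNReal.rpow_mul, one_div_mul_cancel hp'.ne', ENNReal.rpow_one]
  calc (ENNReal.ofReal (ρ ^ (α - n)) * b) ^ conjExp p * s
      = (ENNReal.ofReal (ρ ^ (α - n)) * b * s ^ (1 / conjExp p)) ^ conjExp p := by
        rw [ENNReal.mul_rpow_of_nonneg _ (s ^ _) hp'.le, hpow]
    _ ≤ (2 * 4 ^ n * A * ENNReal.ofReal V ^ (1 / conjExp p) * m) ^ conjExp p := by gcongr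
    _ = (2 * 4 ^ n * A) ^ conjExp p * (m ^ conjExp p * ENNReal.ofReal V) := by
        rw [ENNReal.mul_rpow_of_nonneg _ m hp'.le,
          ENNReal.mul_rpow_of_nonneg _ (ENNReal.ofReal V ^ _) hp'.le, hpow]
        ring
    _ ≤ (2 * 4 ^ n * A) ^ conjExp p * (m ^ conjExp p *
          (2 * volume (Q.set \ (centeredCube x ρ hρ).set))) := by
        gcongr
        exact volume_le_two_mul_shell hn x hρ
    _ = 2 * (2 * 4 ^ n * A) ^ conjExp p *
          ∫⁻ y in Q.set \ (centeredCube x ρ hρ).set, m ^ conjExp p := by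
        rw [setLIntegral_const]
        ring
    _ ≤ _ := by
        gcongr 2 * (2 * 4 ^ n * A) ^ conjExp p * ?_
        refine setLIntegral_mono' (Q.measurableSet_set.diff (Cube.measurableSet_set _))
          fun y hy => ?_
        gcongr
        exact hmle y hy.1

/-- The bump condition and the boundedness of the Orlicz maximal operator imply the testing
condition on the tails of the Riesz kernel. -/
lemma measure_closedBall_mul_tail_le {n : ℕ} (hn : 0 < n) {α p q : ℝ} (hα : 0 < α) (hαn : α < n)
    (hp : 1 < p) (hpq : p < q) {Ψ : ℝ → ℝ} (hΨ : IsYoung Ψ) {u σ : Rn n → ℝ} (hu : IsWeight u)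
    (hσ : Measurable σ) (x : Rn n) {r : ℝ} (hr : 0 < r) :
    (∫⁻ y in Metric.closedBall x r, ENNReal.ofReal (u y)) ^ (1 / q) *
        (∫⁻ y in {y | r ≤ dist y x}, ENNReal.ofReal (σ y) *
          ENNReal.ofReal (dist y x ^ (α - n)) ^ conjExp p) ^ (1 / conjExp p) ≤
      4 ^ (n + 1) * bumpA α (conjExp q) (conjExp p) Ψ σ u *
        orliczMaxNorm n (n * (1 / p - 1 / q)) (assocFn Ψ) (conjExp q) (conjExp p) := by
  have hq : 1 < q := hp.trans hpq
  have hpp := holderConjugate_conjExp hp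
  have hqq := holderConjugate_conjExp hq
  have hp' : 0 < conjExp p := hpp.symm.pos
  have hp'1 : 1 < conjExp p := hpp.symm.lt
  have hq' : 0 < conjExp q := hqq.symm.pos
  have hq0 : 0 < q := hqq.pos
  set B := Metric.closedBall x r with hBdef
  have hB : MeasurableSet B := Metric.isClosed_closedBall.measurableSet
  set h : Rn n → ℝ := B.indicator fun y => u y ^ (1 / conjExp q) with hh
  set A := bumpA α (conjExp q) (conjExp p) Ψ σ u
  set N := orliczMaxNorm n (n * (1 / p - 1 / q)) (assocFn Ψ) (conjExp q) (conjExp p)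
  set M := orliczMax (n * (1 / p - 1 / q)) (assocFn Ψ) h
  set b := ∫⁻ y in B, ENNReal.ofReal (u y) with hb
  set T := ∫⁻ y in {y | r ≤ dist y x}, ENNReal.ofReal (σ y) *
    ENNReal.ofReal (dist y x ^ (α - n)) ^ conjExp p with hT
  have hbtop : b ≠ ∞ :=
    (Integrable.lintegral_lt_top (hu.2.2.integrableOn_isCompact (isCompact_closedBall x r))).ne
  by_cases hb0 : b = 0
  · rw [hb0, ENNReal.zero_rpow_of_pos (by positivity), zero_mul]
    exact zero_le
  have hρ : ∀ j : ℕ, 0 < 2 ^ j * r := fun j => by positivity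
  set D : ℕ → Set (Rn n) := fun j =>
    (centeredCube x (2 * (2 ^ j * r)) (by positivity)).set \ (centeredCube x (2 ^ j * r) (hρ j)).set
    with hD
  have hDm : ∀ j, MeasurableSet (D j) := fun j =>
    (Cube.measurableSet_set _).diff (Cube.measurableSet_set _)
  have hDd : Pairwise (Function.onFun Disjoint D) := by
    rw [pairwise_disjoint_on]
    intro i j hij
    refine disjoint_left.2 fun y hyi hyj => hyj.2 ?_
    refine centeredCube_mono x (by positivity) ?_ hyi.1
    calc 2 * (2 ^ i * r) = 2 ^ (i + 1) * r := by ring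
      _ ≤ 2 ^ j * r := by
        gcongr
        · norm_num
        · exact hij
  have hcover : {y : Rn n | r ≤ dist y x} ⊆
      ⋃ j : ℕ, {y | 2 ^ j * r ≤ dist y x} ∩ Metric.ball x (2 * (2 ^ j * r)) := by
    intro y hy
    obtain ⟨j, hj1, hj2⟩ := exists_nat_pow_near (x := dist y x / r) (y := (2 : ℝ))
      ((one_le_div hr).2 hy) one_lt_two
    refine mem_iUnion.2 ⟨j, (le_div_iff₀ hr).1 hj1, ?_⟩
    have := (div_lt_iff₀ hr).1 hj2
    rw [Metric.mem_ball]
    calc dist y x < 2 ^ (j + 1) * r := this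
      _ = _ := by ring
  have hterm : ∀ j : ℕ, b ^ conjExp p *
      (∫⁻ y in {y | 2 ^ j * r ≤ dist y x} ∩ Metric.ball x (2 * (2 ^ j * r)),
        ENNReal.ofReal (σ y) * ENNReal.ofReal (dist y x ^ (α - n)) ^ conjExp p) ≤
      2 * (2 * 4 ^ n * A) ^ conjExp p * ∫⁻ y in D j, M y ^ conjExp p := by
    intro j
    have hBQ : B ⊆ (centeredCube x (2 * (2 ^ j * r)) (by positivity)).set := by
      refine (Metric.closedBall_subset_ball ?_).trans (ball_subset_centeredCube x _)
      have : (1 : ℝ) ≤ 2 ^ j := one_le_pow₀ one_le_two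
      nlinarith
    refine le_trans ?_ (rpow_mul_lintegral_le_lintegral_orliczMax hn hα hp hpq hΨ hu.1 hu.2.1 x
      (hρ j) hB hBQ (σ := σ))
    rw [ENNReal.mul_rpow_of_nonneg _ b hp'.le, mul_comm _ (b ^ _), mul_assoc]
    gcongr b ^ conjExp p * ?_
    rw [← lintegral_const_mul _ hσ.ennreal_ofReal]
    calc _ ≤ ∫⁻ y in {y | 2 ^ j * r ≤ dist y x} ∩ Metric.ball x (2 * (2 ^ j * r)),
          ENNReal.ofReal ((2 ^ j * r) ^ (α - n)) ^ conjExp p * ENNReal.ofReal (σ y) := by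
          have hm : MeasurableSet ({y | 2 ^ j * r ≤ dist y x} ∩
              Metric.ball x (2 * (2 ^ j * r))) :=
            (isClosed_le continuous_const (continuous_id.dist continuous_const)).measurableSet.inter
              Metric.isOpen_ball.measurableSet
          refine setLIntegral_mono' hm fun y hy => ?_
          rw [mul_comm]
          gcongr ENNReal.ofReal ?_ ^ _ * _
          exact Real.rpow_le_rpow_of_nonpos (hρ j) hy.1 (by linarith)
      _ ≤ _ := lintegral_mono_set (inter_subset_right.trans (ball_subset_centeredCube x _))
  have hsum : b ^ conjExp p * T ≤ 2 * (2 * 4 ^ n * A) ^ conjExp p * ∫⁻ y, M y ^ conjExp p := by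
    calc b ^ conjExp p * T ≤ b ^ conjExp p *
          ∑' j : ℕ, ∫⁻ y in {y | 2 ^ j * r ≤ dist y x} ∩ Metric.ball x (2 * (2 ^ j * r)),
            ENNReal.ofReal (σ y) * ENNReal.ofReal (dist y x ^ (α - n)) ^ conjExp p := by
          gcongr
          exact (lintegral_mono_set hcover).trans (lintegral_iUnion_le _ _)
      _ ≤ ∑' j : ℕ, 2 * (2 * 4 ^ n * A) ^ conjExp p * ∫⁻ y in D j, M y ^ conjExp p := by
          rw [← ENNReal.tsum_mul_left]
          exact ENNReal.tsum_le_tsum hterm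
      _ = 2 * (2 * 4 ^ n * A) ^ conjExp p * ∫⁻ y in ⋃ j, D j, M y ^ conjExp p := by
          rw [ENNReal.tsum_mul_left, lintegral_iUnion hDm hDd]
      _ ≤ _ := by
          gcongr
          exact Measure.restrict_le_self
  have hroot : b * T ^ (1 / conjExp p) ≤ 4 ^ (n + 1) * A * LpE M (conjExp p) := by
    have hpow : ∀ z : ℝ≥0∞, (z ^ conjExp p) ^ (1 / conjExp p) = z := by
      intro z
      rw [← ENNReal.rpow_mul, mul_one_div_cancel hp'.ne', ENNReal.rpow_one]
    have h1 := ENNReal.rpow_le_rpow hsum (z := 1 / conjExp p) (by positivity)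
    rw [ENNReal.mul_rpow_of_nonneg _ _ (by positivity), hpow,
      ENNReal.mul_rpow_of_nonneg _ _ (by positivity),
      ENNReal.mul_rpow_of_nonneg _ _ (by positivity), hpow] at h1
    refine h1.trans ?_
    have h2 : (2 : ℝ≥0∞) ^ (1 / conjExp p) ≤ 2 := by
      calc (2 : ℝ≥0∞) ^ (1 / conjExp p) ≤ 2 ^ (1 : ℝ) :=
            ENNReal.rpow_le_rpow_of_exponent_le one_le_two
              ((div_le_one hp').2 hp'1.le)
        _ = 2 := ENNReal.rpow_one _
    calc (2 : ℝ≥0∞) ^ (1 / conjExp p) * (2 * 4 ^ n * A) * LpE M (conjExp p)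
        ≤ 2 * (2 * 4 ^ n * A) * LpE M (conjExp p) := by gcongr
      _ = 2 * 2 * 4 ^ n * A * LpE M (conjExp p) := by ring
      _ = _ := by
        rw [show (2 : ℝ≥0∞) * 2 = 4 by norm_num, pow_succ']
  have hLp : Lp0 h (conjExp q) = b ^ (1 / conjExp q) := by
    unfold Lp0
    congr 1
    rw [hb, ← lintegral_indicator hB]
    refine lintegral_congr fun y => ?_
    by_cases hy : y ∈ B
    · rw [indicator_of_mem hy, hh, indicator_of_mem hy,
        abs_of_nonneg (Real.rpow_nonneg (hu.2.1 y) _),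
        ENNReal.ofReal_rpow_of_nonneg (Real.rpow_nonneg (hu.2.1 y) _) hq'.le,
        ← Real.rpow_mul (hu.2.1 y), one_div_mul_cancel hq'.ne', Real.rpow_one]
    · rw [indicator_of_notMem hy, hh, indicator_of_notMem hy, abs_zero, ENNReal.ofReal_zero,
        ENNReal.zero_rpow_of_pos hq']
  have hc0 : b ^ (1 / conjExp q) ≠ 0 := by
    simp [ENNReal.rpow_eq_zero_iff, hb0, hbtop]
  have hct : b ^ (1 / conjExp q) ≠ ∞ := ENNReal.rpow_ne_top_of_nonneg (by positivity) hbtop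
  have hMN : LpE M (conjExp p) ≤ N * b ^ (1 / conjExp q) := by
    rw [← ENNReal.div_le_iff hc0 hct, ← hLp]
    exact le_iSup₂ (f := fun (f : Rn n → ℝ) (_ : Measurable f) =>
      LpE (orliczMax (n * (1 / p - 1 / q)) (assocFn Ψ) f) (conjExp p) / Lp0 f (conjExp q)) h
      ((hu.1.pow_const _).indicator hB)
  have hsplit : b = b ^ (1 / q) * b ^ (1 / conjExp q) := by
    rw [← ENNReal.rpow_add _ _ hb0 hbtop, one_div, one_div, hqq.inv_add_inv_eq_one,
      ENNReal.rpow_one]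
  rw [← ENNReal.mul_le_mul_iff_left hc0 hct]
  calc b ^ (1 / q) * T ^ (1 / conjExp p) * b ^ (1 / conjExp q)
      = (b ^ (1 / q) * b ^ (1 / conjExp q)) * T ^ (1 / conjExp p) := by ring
    _ = b * T ^ (1 / conjExp p) := by rw [← hsplit]
    _ ≤ 4 ^ (n + 1) * A * LpE M (conjExp p) := hroot
    _ ≤ 4 ^ (n + 1) * A * (N * b ^ (1 / conjExp q)) := by gcongr
    _ = _ := by ring

lemma dist_le_eucNorm {n : ℕ} (x y : Rn n) : dist y x ≤ eucNorm (x - y) := by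
  refine (dist_pi_le_iff (Real.sqrt_nonneg _)).2 fun i => ?_
  rw [Real.dist_eq, abs_sub_comm]
  refine Real.abs_le_sqrt ?_
  exact Finset.single_le_sum (f := fun i => (x - y) i ^ 2) (fun j _ => sq_nonneg _)
    (Finset.mem_univ i)

lemma measurable_eucNorm {n : ℕ} : Measurable (eucNorm : Rn n → ℝ) := by
  unfold eucNorm
  fun_prop

/-- Weak type estimate for the Riesz potential on a function of finite norm. -/
lemma ofReal_mul_measure_riesz_le {n : ℕ} (hn : 0 < n) {N : ℕ} {τ : ℝ} (hτ : 1 < τ)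
    (hN : IsEmpty (Besicovitch.SatelliteConfig (Rn n) N τ)) {α p q κ F t : ℝ}
    (hαn : α < n) (hp : 1 < p) (hpq : p < q) (hκ : 0 < κ) (hF : 0 < F) (ht : 0 < t)
    {u σ : Rn n → ℝ} (hu : IsWeight u) (hσ : Measurable σ)
    (hK : ∀ x r, 0 < r → (∫⁻ y in Metric.closedBall x r, ENNReal.ofReal (u y)) ^ (1 / q) *
        (∫⁻ y in {y | r ≤ dist y x}, ENNReal.ofReal (σ y) *
          ENNReal.ofReal (dist y x ^ (α - n)) ^ conjExp p) ^ (1 / conjExp p) ≤ ENNReal.ofReal κ)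
    {f : Rn n → ℝ≥0∞} (hf : Measurable f)
    (hfF : ∫⁻ y, f y ^ p * ENNReal.ofReal (σ y) ≤ ENNReal.ofReal (F ^ p)) :
    ENNReal.ofReal t * (∫⁻ x in {x | ENNReal.ofReal t < riesz α (mulW f σ) x},
        ENNReal.ofReal (u x)) ^ (1 / q) ≤
      ENNReal.ofReal (2 * (1 + N * nestedBallConst p q ^ p) ^ (1 / q) * (κ * F)) := by
  have hpp := holderConjugate_conjExp hp
  have hp0 : 0 < p := hpp.pos
  have hq0 : 0 < q := hp0.trans hpq
  have hC := nestedBallConst_pos hp0 hpq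
  have : Nonempty (Fin n) := ⟨⟨0, hn⟩⟩
  set ν : Measure (Rn n) := volume.withDensity fun x => ENNReal.ofReal (u x) with hν
  set μ : Measure (Rn n) := volume.withDensity fun x => ENNReal.ofReal (σ x) with hμ
  have : NullSingletonClass ν :=
    ⟨fun x => withDensity_absolutelyContinuous _ _ (measure_singleton x)⟩
  have hνapp : ∀ s, ν s = ∫⁻ x in s, ENNReal.ofReal (u x) := fun s => withDensity_apply' _ s
  have hfin : ∀ x r, ν (Metric.closedBall x r) ≠ ∞ := fun x r => by
    rw [hνapp]
    exact (Integrable.lintegral_lt_top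
      (hu.2.2.integrableOn_isCompact (isCompact_closedBall x r))).ne
  set k : Rn n → Rn n → ℝ≥0∞ := fun x y => ENNReal.ofReal (eucNorm (x - y) ^ (α - n)) with hk
  have hkm : ∀ x, Measurable (k x) := fun x =>
    ((measurable_eucNorm.comp (measurable_const.sub measurable_id)).pow_const _).ennreal_ofReal
  have hk0 : ∀ x, k x x = 0 := fun x => by
    simp [hk, eucNorm, Real.zero_rpow (show α - n ≠ 0 by linarith)]
  have hKk : ∀ x r, 0 < r → ν (Metric.closedBall x r) ^ (1 / q) *
      (∫⁻ y in {y | r ≤ dist y x}, k x y ^ conjExp p ∂μ) ^ (1 / conjExp p) ≤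
        ENNReal.ofReal κ := by
    intro x r hr
    refine le_trans ?_ (hK x r hr)
    have hm : MeasurableSet {y : Rn n | r ≤ dist y x} :=
      (isClosed_le continuous_const (continuous_id.dist continuous_const)).measurableSet
    have hp' : 0 < conjExp p := hpp.symm.pos
    rw [hνapp, hμ, restrict_withDensity hm, lintegral_withDensity_eq_lintegral_mul _
      hσ.ennreal_ofReal ((hkm x).pow_const _)]
    refine mul_le_mul' le_rfl (ENNReal.rpow_le_rpow ?_ (by positivity))
    refine setLIntegral_mono' hm fun y hy => ?_
    simp only [Pi.mul_apply, hk]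
    gcongr ENNReal.ofReal (σ y) * (ENNReal.ofReal ?_) ^ _
    exact Real.rpow_le_rpow_of_nonpos (hr.trans_le hy) (dist_le_eucNorm x y) (by linarith)
  have hfF' : ∫⁻ y, f y ^ p ∂μ ≤ ENNReal.ofReal (F ^ p) := by
    rw [hμ, lintegral_withDensity_eq_lintegral_mul _ hσ.ennreal_ofReal (hf.pow_const _)]
    refine le_trans (le_of_eq ?_) hfF
    exact lintegral_congr fun y => mul_comm _ _
  have hriesz : ∀ x, riesz α (mulW f σ) x = ∫⁻ y, f y * k x y ∂μ := by
    intro x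
    have h := lintegral_withDensity_eq_lintegral_mul (volume : Measure (Rn n)) hσ.ennreal_ofReal
      (g := fun y => f y * k x y) (hf.mul (hkm x))
    rw [hμ, h]
    refine lintegral_congr fun y => ?_
    simp only [mulW, hk, Pi.mul_apply]
    ring
  set R : ℝ := (2 * F * κ / t) ^ q with hR
  have hR0 : 0 < R := by positivity
  have hRq : R ^ (1 / q) = 2 * F * κ / t := by
    rw [hR, ← Real.rpow_mul (by positivity), mul_one_div_cancel hq0.ne', Real.rpow_one]
  have htR : 2 * F * κ * R ^ (-(1 / q)) = t := by
    rw [Real.rpow_neg hR0.le, hRq]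
    field_simp
  have hmain := measure_superlevel_kernel_le hτ hN μ ν hfin hpp hpq hκ hF hR0 hkm hk0 hf hKk hfF'
  rw [htR] at hmain
  simp_rw [hriesz, ← hνapp]
  calc _ ≤ ENNReal.ofReal t *
        ENNReal.ofReal ((1 + N * nestedBallConst p q ^ p) * R) ^ (1 / q) := by gcongr
    _ = _ := by
      rw [ENNReal.ofReal_rpow_of_pos (by positivity), ← ENNReal.ofReal_mul ht.le,
        Real.mul_rpow (by positivity) hR0.le, hRq]
      congr 1
      field_simp

lemma weakLpW_riesz_le {n : ℕ} (hn : 0 < n) {N : ℕ} {τ : ℝ} (hτ : 1 < τ)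
    (hN : IsEmpty (Besicovitch.SatelliteConfig (Rn n) N τ)) {α p q : ℝ}
    (hαn : α < n) (hp : 1 < p) (hpq : p < q) {K : ℝ≥0∞} (hKtop : K ≠ ∞)
    {u σ : Rn n → ℝ} (hu : IsWeight u) (hσ : Measurable σ)
    (hK : ∀ x r, 0 < r → (∫⁻ y in Metric.closedBall x r, ENNReal.ofReal (u y)) ^ (1 / q) *
        (∫⁻ y in {y | r ≤ dist y x}, ENNReal.ofReal (σ y) *
          ENNReal.ofReal (dist y x ^ (α - n)) ^ conjExp p) ^ (1 / conjExp p) ≤ K)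
    {f : Rn n → ℝ≥0∞} (hf : Measurable f) (hftop : LpW f p σ ≠ ∞) :
    WeakLpW (riesz α (mulW f σ)) q u ≤
      ENNReal.ofReal (2 * (1 + N * nestedBallConst p q ^ p) ^ (1 / q)) * K * LpW f p σ := by
  have hp0 : 0 < p := zero_lt_one.trans hp
  have hC := nestedBallConst_pos hp0 hpq
  refine iSup₂_le fun t ht => ?_
  have hlim : Filter.Tendsto (fun ε : ℝ => ENNReal.ofReal
      (2 * (1 + N * nestedBallConst p q ^ p) ^ (1 / q) *
        ((K.toReal + ε) * ((LpW f p σ).toReal + ε)))) (nhdsWithin 0 (Ioi 0))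
      (nhds (ENNReal.ofReal (2 * (1 + N * nestedBallConst p q ^ p) ^ (1 / q) *
        ((K.toReal + 0) * ((LpW f p σ).toReal + 0))))) := by
    refine Filter.Tendsto.mono_left ?_ nhdsWithin_le_nhds
    exact (ENNReal.continuous_ofReal.comp (by fun_prop)).tendsto 0
  have heq : ENNReal.ofReal (2 * (1 + N * nestedBallConst p q ^ p) ^ (1 / q) *
        ((K.toReal + 0) * ((LpW f p σ).toReal + 0))) =
      ENNReal.ofReal (2 * (1 + N * nestedBallConst p q ^ p) ^ (1 / q)) * K * LpW f p σ := by
    rw [add_zero, add_zero, ENNReal.ofReal_mul (by positivity),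
      ENNReal.ofReal_mul ENNReal.toReal_nonneg, ENNReal.ofReal_toReal hKtop,
      ENNReal.ofReal_toReal hftop, mul_assoc]
  rw [← heq]
  refine ge_of_tendsto hlim ?_
  filter_upwards [self_mem_nhdsWithin] with ε hε
  have hε' : 0 < ε := hε
  have hF0 : 0 < (LpW f p σ).toReal + ε := by positivity
  refine ofReal_mul_measure_riesz_le hn hτ hN hαn hp hpq (by positivity) hF0 ht hu hσ
    (fun x r hr => (hK x r hr).trans ?_) hf ?_
  · exact ENNReal.le_ofReal_iff_toReal_le hKtop (by positivity) |>.2 (by linarith)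
  · rw [← ENNReal.ofReal_rpow_of_pos hF0]
    have h1 : LpW f p σ ≤ ENNReal.ofReal ((LpW f p σ).toReal + ε) :=
      ENNReal.le_ofReal_iff_toReal_le hftop hF0.le |>.2 (by linarith)
    refine le_trans (le_of_eq ?_) (ENNReal.rpow_le_rpow h1 hp0.le)
    rw [LpW, ← ENNReal.rpow_mul, one_div_mul_cancel hp0.ne', ENNReal.rpow_one]

/-- separated bump, weak type, for the Riesz potential:
with `β = n(1/p - 1/q)`, if `Ψ̄ ∈ B^β_{q'}` and `[σ,u]_{A^α_{q',p',Ψ}} < ∞`, then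
`‖I_α(·σ)‖_{L^p(σ)→L^{q,∞}(u)} ≤ C [σ,u]_{A^α_{q',p',Ψ}} ‖M_{β,Ψ̄}‖_{L^{q'}→L^{p'}}`. -/
theorem stmt12 (n : ℕ) (hn : 0 < n) (α p q : ℝ) (hα : 0 < α) (hαn : α < n)
    (hp : 1 < p) (hpq : p < q) :
    ∃ C : ℝ≥0∞, 0 < C ∧ C < ∞ ∧
      ∀ (Ψ : ℝ → ℝ) (u σ : Rn n → ℝ), IsYoung Ψ →
        BCond (assocFn Ψ) (conjExp q) (conjExp p) → IsWeight u → IsWeight σ →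
        bumpA α (conjExp q) (conjExp p) Ψ σ u < ∞ →
        opNormWeak (riesz α) p q σ u ≤
          C * bumpA α (conjExp q) (conjExp p) Ψ σ u *
            orliczMaxNorm n (n * (1 / p - 1 / q)) (assocFn Ψ) (conjExp q) (conjExp p) := by
  obtain ⟨N, τ, hτ, hN⟩ := HasBesicovitchCovering.no_satelliteConfig (α := Rn n)
  have hC := nestedBallConst_pos (zero_lt_one.trans hp) hpq
  refine ⟨ENNReal.ofReal (2 * (1 + N * nestedBallConst p q ^ p) ^ (1 / q)) * 4 ^ (n + 1),
    ENNReal.mul_pos (ENNReal.ofReal_pos.2 (by positivity)).ne' (by positivity),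
    ENNReal.mul_lt_top ENNReal.ofReal_lt_top (ENNReal.pow_lt_top (by norm_num)), ?_⟩
  intro Ψ u σ hΨ _ hu hσ _
  have hK := fun x r hr =>
    measure_closedBall_mul_tail_le hn hα hαn hp hpq hΨ hu hσ.1 x (r := r) hr
  rw [mul_assoc, mul_assoc, ← mul_assoc (4 ^ (n + 1))]
  set K := 4 ^ (n + 1) * bumpA α (conjExp q) (conjExp p) Ψ σ u *
    orliczMaxNorm n (n * (1 / p - 1 / q)) (assocFn Ψ) (conjExp q) (conjExp p)
  by_cases hKtop : K = ∞
  · rw [hKtop, ENNReal.mul_top (ENNReal.ofReal_pos.2 (by positivity)).ne']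
    exact le_top
  refine iSup₂_le fun f hf => ?_
  by_cases hftop : LpW f p σ = ∞
  · rw [hftop, ENNReal.div_top]
    exact zero_le
  exact ENNReal.div_le_of_le_mul
    (weakLpW_riesz_le hn hτ hN hαn hp hpq hKtop hu hσ.1 hK hf hftop)
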